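/- Let q* be the largest point of the support of F and suppose F({q*}) > 0. Then for Pr-almost all ω the directing measure μ_ω is discrete, i.e. μ_ω is a countable sum of point masses with total mass 1 (equivalently, for μ_ω-almost all x, μ_ω({x}) > 0). -/

import Mathlib

open MeasureTheory ProbabilityTheory RealInnerProductSpace

noncomputable section

/-- The space of infinite real matrices. -/
abbrev Mat := ℕ → ℕ → ℝ

/-- The strictly upper-triangular part of the top-left `n × n` submatrix. -/
def subU (n : ℕ) (M : Mat) : {p : Fin n × Fin n // p.1 < p.2} → ℝ :=
  fun p => M p.1.1 p.1.2

/-- `R` is a Gram–de Finetti matrix under `P`. -/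
def IsGramDeFinetti {Ω : Type*} [MeasurableSpace Ω] (P : Measure Ω) (R : Ω → Mat) : Prop :=
  Measurable R ∧
  (∀ᵐ ω ∂P, ∀ i j, R ω i j ∈ Set.Icc (-1 : ℝ) 1) ∧
  (∀ᵐ ω ∂P, ∀ i j, R ω i j = R ω j i) ∧
  (∀ᵐ ω ∂P, ∀ (n : ℕ) (c : Fin n → ℝ),
    0 ≤ ∑ i : Fin n, ∑ j : Fin n, c i * c j * R ω i j) ∧
  (∀ (n : ℕ) (ρ : Equiv.Perm (Fin n)),
    Measure.map (fun ω => fun i j : Fin n => R ω (ρ i) (ρ j)) P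
      = Measure.map (fun ω => fun i j : Fin n => R ω i j) P)

/-- `R` satisfies the Ghirlanda–Guerra identities under `P`. -/
def SatisfiesGGI {Ω : Type*} [MeasurableSpace Ω] (P : Measure Ω) (R : Ω → Mat) : Prop :=
  ∀ (n : ℕ), 2 ≤ n → ∀ (f : ({p : Fin n × Fin n // p.1 < p.2} → ℝ) → ℝ),
    Measurable f → (∃ C, ∀ x, |f x| ≤ C) →
    ∀ (ψ : ℝ → ℝ), Measurable ψ → (∃ C, ∀ x, |ψ x| ≤ C) →
    ∫ ω, f (subU n (R ω)) * ψ (R ω 0 n) ∂P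
      = (1 / n) * (∫ ω, f (subU n (R ω)) ∂P) * (∫ ω, ψ (R ω 0 1) ∂P)
        + (1 / n) * ∑ l ∈ Finset.Ico 1 n, ∫ ω, f (subU n (R ω)) * ψ (R ω 0 l) ∂P

variable {H : Type*} [NormedAddCommGroup H] [InnerProductSpace ℝ H]
  [TopologicalSpace.SeparableSpace H] [MeasurableSpace H] [BorelSpace H]

/-- The Gram matrix (plus diagonal perturbation) generated by a sequence in `H × ℝ`. -/
def genMat (x : ℕ → H × ℝ) : Mat :=
  fun i j => ⟪(x i).1, (x j).1⟫ + if i = j then (x i).2 else 0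

/-- `ν` is the law of an i.i.d. sequence with marginal `η`: all finite-dimensional
cylinder probabilities are products. -/
def IsIIDFrom (ν : Measure (ℕ → H × ℝ)) (η : Measure (H × ℝ)) : Prop :=
  ∀ (n : ℕ) (A : Fin n → Set (H × ℝ)), (∀ i, MeasurableSet (A i)) →
    ν {x | ∀ i : Fin n, x (i : ℕ) ∈ A i} = ∏ i : Fin n, η (A i)

/-- Two distinct terms of an i.i.d. sequence have the product law. -/
theorem IsIIDFrom.map_pair {E : Type*} [NormedAddCommGroup E] [TopologicalSpace.SeparableSpace E]
    [MeasurableSpace E] {ν : Measure (ℕ → E × ℝ)}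
    {η : Measure (E × ℝ)} [IsProbabilityMeasure η] (h : IsIIDFrom ν η) {i j : ℕ} (hij : i ≠ j) :
    ν.map (fun x => (x i, x j)) = η.prod η := by
  symm
  refine Measure.prod_eq fun s t hs ht => ?_
  rw [Measure.map_apply (by fun_prop) (hs.prod ht)]
  let a : Fin (max i j + 1) := ⟨i, by omega⟩
  let b : Fin (max i j + 1) := ⟨j, by omega⟩
  have hab : a ≠ b := fun e => hij (congrArg Fin.val e)
  let A : Fin (max i j + 1) → Set (E × ℝ) :=
    fun k => if k = a then s else if k = b then t else Set.univ
  have hA : ∀ k, MeasurableSet (A k) := by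
    intro k
    dsimp only [A]
    split_ifs
    exacts [hs, ht, MeasurableSet.univ]
  have hset : (fun x : ℕ → E × ℝ => (x i, x j)) ⁻¹' s ×ˢ t
      = {x | ∀ k : Fin (max i j + 1), x (k : ℕ) ∈ A k} := by
    ext x
    constructor
    · rintro ⟨h₁, h₂⟩ k
      dsimp only [A]
      split_ifs with e₁ e₂
      · rw [e₁]; exact h₁
      · rw [e₂]; exact h₂
      · trivial
    · intro hx
      have h₁ := hx a
      have h₂ := hx b
      simp only [A, if_true, if_neg hab.symm] at h₁ h₂
      exact ⟨h₁, h₂⟩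
  rw [hset, h _ A hA, Fintype.prod_eq_mul a b hab]
  · simp [A, hab.symm]
  · rintro k ⟨h₁, h₂⟩
    simp [A, h₁, h₂]

theorem measurable_genMat : Measurable (genMat : (ℕ → H × ℝ) → Mat) := by
  have : SecondCountableTopology H := UniformSpace.secondCountable_of_separable H
  refine measurable_pi_iff.2 fun i => measurable_pi_iff.2 fun j => ?_
  unfold genMat
  refine Measurable.add (Measurable.inner (by fun_prop) (by fun_prop)) ?_
  split_ifs
  · fun_prop
  · exact measurable_const

/-- The matrices whose first row avoids the value `q` at the positions `1, …, n - 1`. -/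
def rowAvoids (q : ℝ) (n : ℕ) : Set Mat := {M | ∀ l, 0 < l → l < n → M 0 l ≠ q}

theorem measurableSet_rowAvoids (q : ℝ) (n : ℕ) : MeasurableSet (rowAvoids q n) := by
  have : rowAvoids q n = ⋂ l : ℕ, ⋂ _ : 0 < l, ⋂ _ : l < n, {M : Mat | M 0 l ≠ q} := by
    ext M; simp [rowAvoids]
  rw [this]
  refine MeasurableSet.iInter fun l => MeasurableSet.iInter fun _ => MeasurableSet.iInter fun _ => ?_
  have hm : Measurable fun M : Mat => M 0 l := by fun_prop
  exact (measurableSet_eq_fun hm measurable_const).compl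

/-- The Ghirlanda–Guerra identities give a recursion for the probability that the first
row avoids a given value. -/
theorem SatisfiesGGI.measureReal_rowAvoids_succ {Ω : Type*} [MeasurableSpace Ω] {P : Measure Ω}
    [IsProbabilityMeasure P] {R : Ω → Mat} (hR : Measurable R) (h : SatisfiesGGI P R) (q : ℝ)
    {n : ℕ} (hn : 2 ≤ n) :
    P.real (R ⁻¹' rowAvoids q (n + 1))
      = P.real (R ⁻¹' rowAvoids q n)
        - 1 / n * P.real (R ⁻¹' rowAvoids q n) * P.real {ω | R ω 0 1 = q} := by
  classical
  let T : Set ({p : Fin n × Fin n // p.1 < p.2} → ℝ) := {u | ∀ p, (p.1.1 : ℕ) = 0 → u p ≠ q}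
  have hT : MeasurableSet T := by
    have : T = ⋂ p : {p : Fin n × Fin n // p.1 < p.2}, ⋂ _ : (p.1.1 : ℕ) = 0, {u | u p ≠ q} := by
      ext u; simp [T]
    rw [this]
    refine MeasurableSet.iInter fun p => MeasurableSet.iInter fun _ => ?_
    exact (measurableSet_eq_fun (measurable_pi_apply p) measurable_const).compl
  have hTS : ∀ M : Mat, subU n M ∈ T ↔ M ∈ rowAvoids q n := by
    intro M
    constructor
    · intro hM l hl hln
      exact hM ⟨(⟨0, by omega⟩, ⟨l, hln⟩), hl⟩ rfl
    · rintro hM ⟨⟨a, b⟩, hab⟩ ha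
      have hab' : (a : ℕ) < b := hab
      have ha' : (a : ℕ) = 0 := ha
      have := hM b (by omega) b.2
      simpa [subU, ha'] using this
  have hbound : ∀ {α : Type} (s : Set α), ∃ C : ℝ, ∀ x, |s.indicator 1 x| ≤ C := fun s =>
    ⟨1, fun x => by by_cases hx : x ∈ s <;> simp [hx]⟩
  have key := h n hn (T.indicator fun _ => 1) (measurable_const.indicator hT) (hbound T)
    (({q} : Set ℝ).indicator 1) (measurable_one.indicator (measurableSet_singleton q))
    (hbound {q})
  have hS := hR (measurableSet_rowAvoids q n)
  have hentry : ∀ l, MeasurableSet {ω | R ω 0 l = q} := fun l =>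
    measurableSet_eq_fun (by fun_prop) measurable_const
  have hf : ∀ ω, T.indicator (fun _ => (1 : ℝ)) (subU n (R ω))
      = (R ⁻¹' rowAvoids q n).indicator 1 ω := by
    intro ω
    simp only [Set.indicator_apply, hTS, Set.mem_preimage, Pi.one_apply]
  have hg : ∀ l ω, ({q} : Set ℝ).indicator (1 : ℝ → ℝ) (R ω 0 l)
      = {ω | R ω 0 l = q}.indicator 1 ω := by
    intro l ω
    simp only [Set.indicator_apply, Set.mem_singleton_iff, Set.mem_ofPred_eq, Pi.one_apply]
  simp only [hf, hg] at key
  have hmul : ∀ l, ∫ ω, (R ⁻¹' rowAvoids q n).indicator (1 : Ω → ℝ) ω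
        * {ω | R ω 0 l = q}.indicator (1 : Ω → ℝ) ω ∂P
      = P.real (R ⁻¹' rowAvoids q n ∩ {ω | R ω 0 l = q}) := by
    intro l
    rw [← integral_indicator_one (hS.inter (hentry l)), Set.inter_indicator_one]
    rfl
  simp only [hmul] at key
  have hzero : ∑ l ∈ Finset.Ico 1 n, P.real (R ⁻¹' rowAvoids q n ∩ {ω | R ω 0 l = q}) = 0 := by
    refine Finset.sum_eq_zero fun l hl => ?_
    obtain ⟨h₁, h₂⟩ := Finset.mem_Ico.1 hl
    have : R ⁻¹' rowAvoids q n ∩ {ω | R ω 0 l = q} = ∅ := by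
      ext ω
      simp only [Set.mem_inter_iff, Set.mem_empty_iff_false, iff_false]
      exact fun hω => hω.1 l h₁ h₂ hω.2
    rw [this, measureReal_empty]
  rw [hzero, integral_indicator_one hS, integral_indicator_one (hentry 1)] at key
  have hsplit := measureReal_inter_add_sdiff (μ := P) (s := R ⁻¹' rowAvoids q n) (hentry n)
  have hdiff : R ⁻¹' rowAvoids q n \ {ω | R ω 0 n = q} = R ⁻¹' rowAvoids q (n + 1) := by
    ext ω
    constructor
    · rintro ⟨h₁, h₂⟩ l hl hln
      rcases Nat.lt_succ_iff_lt_or_eq.1 hln with hlt | rfl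
      · exact h₁ l hl hlt
      · exact h₂
    · exact fun hω => ⟨fun l hl hln => hω l hl (by omega), hω n (by omega) (by omega)⟩
  rw [hdiff] at hsplit
  linarith

/-- A value taken by `R_{1,2}` with positive probability almost surely occurs in the first row
off the diagonal. -/
theorem SatisfiesGGI.measure_forall_ne_eq_zero {Ω : Type*} [MeasurableSpace Ω] {P : Measure Ω}
    [IsProbabilityMeasure P] {R : Ω → Mat} (hR : Measurable R) (h : SatisfiesGGI P R) {q : ℝ}
    (hq : 0 < P {ω | R ω 0 1 = q}) : P {ω | ∀ l, 0 < l → R ω 0 l ≠ q} = 0 := by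
  set p := P.real {ω | R ω 0 1 = q}
  set N := {ω | ∀ l, 0 < l → R ω 0 l ≠ q}
  have hp : 0 < p := ENNReal.toReal_pos hq.ne' (measure_ne_top _ _)
  let a : ℕ → ℝ := fun k => P.real (R ⁻¹' rowAvoids q (k + 2))
  have ha : ∀ k, P.real N ≤ a k := fun k => measureReal_mono fun ω hω l hl _ => hω l hl
  have hstep : ∀ k : ℕ, P.real N * p * (1 / ((k + 2 : ℕ) : ℝ)) ≤ a k - a (k + 1) := by
    intro k
    have e := h.measureReal_rowAvoids_succ hR q (n := k + 2) (by omega)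
    have e' : a (k + 1) = a k - 1 / ((k + 2 : ℕ) : ℝ) * a k * p := e
    have hk : 0 ≤ p * (1 / ((k + 2 : ℕ) : ℝ)) := by positivity
    have := mul_le_mul_of_nonneg_right (ha k) hk
    linarith
  have hsum : Summable fun k : ℕ => P.real N * p * (1 / ((k + 2 : ℕ) : ℝ)) := by
    refine summable_of_sum_range_le (c := 1) (fun k => by positivity) fun n => ?_
    calc _ ≤ ∑ k ∈ Finset.range n, (a k - a (k + 1)) := Finset.sum_le_sum fun k _ => hstep k
      _ = a 0 - a n := Finset.sum_range_sub' a n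
      _ ≤ 1 := by
        have h₁ : a 0 ≤ 1 := measureReal_le_one
        have h₂ : 0 ≤ a n := measureReal_nonneg
        linarith
  by_contra hN
  have hN' : 0 < P.real N := ENNReal.toReal_pos hN (measure_ne_top _ _)
  rw [summable_mul_left_iff (mul_pos hN' hp).ne',
    summable_nat_add_iff (f := fun k : ℕ => 1 / (k : ℝ)) 2] at hsum
  exact Real.not_summable_one_div_natCast hsum

/-- If the inner product of two independent samples is almost surely at most `q`, then
almost every sample has squared norm at most `q`. -/
theorem ae_inner_self_le_of_prod {E : Type*} [NormedAddCommGroup E] [InnerProductSpace ℝ E]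
    [TopologicalSpace.SeparableSpace E] [MeasurableSpace E] {μ : Measure E} [SFinite μ] {q : ℝ}
    (h : μ.prod μ {z | q < ⟪z.1, z.2⟫} = 0) : ∀ᵐ x ∂μ, ⟪x, x⟫ ≤ q := by
  have : SecondCountableTopology E := UniformSpace.secondCountable_of_separable E
  refine measure_null_of_locally_null _ fun x hx => ?_
  have hx' : q < ⟪x, x⟫ := not_le.1 hx
  have hopen : IsOpen {z : E × E | q < ⟪z.1, z.2⟫} :=
    isOpen_lt continuous_const (continuous_fst.inner continuous_snd)
  obtain ⟨u, hu, v, hv, huv⟩ := mem_nhds_prod_iff.1 (hopen.mem_nhds (show (x, x) ∈ _ from hx'))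
  refine ⟨u ∩ v, mem_nhdsWithin_of_mem_nhds (Filter.inter_mem hu hv), ?_⟩
  have hsub : (u ∩ v) ×ˢ (u ∩ v) ⊆ u ×ˢ v :=
    Set.prod_mono Set.inter_subset_left Set.inter_subset_right
  have := measure_mono_null (hsub.trans huv) h
  rw [Measure.prod_prod] at this
  exact mul_self_eq_zero.1 this

/-- For an i.i.d. sequence whose first term almost surely has inner product `q` with some later
term, almost every sample has inner product `q` with a set of positive measure. -/
theorem IsIIDFrom.ae_pos_measure_inner_eq {ν : Measure (ℕ → H × ℝ)} {η : Measure (H × ℝ)}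
    [IsProbabilityMeasure η] (h : IsIIDFrom ν η) {q : ℝ}
    (hν : ν {x | ∀ l, 0 < l → ⟪(x 0).1, (x l).1⟫ ≠ q} = 0) :
    ∀ᵐ x ∂(η.map Prod.fst), 0 < η.map Prod.fst {y | ⟪x, y⟫ = q} := by
  have : SecondCountableTopology H := UniformSpace.secondCountable_of_separable H
  set μ := η.map Prod.fst with hμ
  have : IsProbabilityMeasure μ := Measure.isProbabilityMeasure_map measurable_fst.aemeasurable
  have hpair : ∀ l, 0 < l → ν.map (fun x => ((x 0).1, (x l).1)) = μ.prod μ := by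
    intro l hl
    rw [hμ, Measure.map_prod_map _ _ measurable_fst measurable_fst, ← h.map_pair hl.ne,
      Measure.map_map (by fun_prop) (by fun_prop)]
    rfl
  have hE : MeasurableSet {z : H × H | ⟪z.1, z.2⟫ = q} :=
    measurableSet_eq_fun (measurable_fst.inner measurable_snd) measurable_const
  have hB : MeasurableSet {x : H | μ {y | ⟪x, y⟫ = q} = 0} :=
    measurable_measure_prodMk_left hE (measurableSet_singleton 0)
  set B := {x : H | μ {y | ⟪x, y⟫ = q} = 0}
  have hnull : ∀ l, 0 < l → ν {x | (x 0).1 ∈ B ∧ ⟪(x 0).1, (x l).1⟫ = q} = 0 := by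
    intro l hl
    have hm : MeasurableSet ((B ×ˢ Set.univ) ∩ {z : H × H | ⟪z.1, z.2⟫ = q}) :=
      (hB.prod MeasurableSet.univ).inter hE
    have e : μ.prod μ ((B ×ˢ Set.univ) ∩ {z : H × H | ⟪z.1, z.2⟫ = q}) = 0 := by
      rw [Measure.measure_prod_null hm]
      refine Filter.Eventually.of_forall fun x => ?_
      by_cases hx : x ∈ B
      · exact measure_mono_null (fun y hy => hy.2) hx
      · have : Prod.mk x ⁻¹' ((B ×ˢ Set.univ) ∩ {z : H × H | ⟪z.1, z.2⟫ = q}) = ∅ := by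
          ext y; simp [hx]
        change μ (Prod.mk x ⁻¹' _) = 0
        rw [this, measure_empty]
    rw [← hpair l hl, Measure.map_apply (by fun_prop) hm] at e
    refine measure_mono_null (fun x hx => ?_) e
    exact ⟨⟨hx.1, trivial⟩, hx.2⟩
  have hB0 : ν {x | (x 0).1 ∈ B} = 0 := by
    refine measure_mono_null (t := {x | ∀ l, 0 < l → ⟪(x 0).1, (x l).1⟫ ≠ q} ∪
      ⋃ l : ℕ, ⋃ _ : 0 < l, {x | (x 0).1 ∈ B ∧ ⟪(x 0).1, (x l).1⟫ = q}) ?_ ?_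
    · intro x hx
      by_cases hl : ∀ l, 0 < l → ⟪(x 0).1, (x l).1⟫ ≠ q
      · exact Or.inl hl
      · push Not at hl
        obtain ⟨l, hl, e⟩ := hl
        exact Or.inr (Set.mem_iUnion₂.2 ⟨l, hl, hx, e⟩)
    · exact measure_union_null hν
        (measure_iUnion_null fun l => measure_iUnion_null fun hl => hnull l hl)
  have hBμ : μ B = 0 := by
    have e := hpair 1 one_pos
    have e' : ν {x | (x 0).1 ∈ B} = μ.prod μ (B ×ˢ Set.univ) := by
      rw [← e, Measure.map_apply (by fun_prop) (hB.prod MeasurableSet.univ)]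
      congr 1
      ext x
      simp
    rw [hB0, Measure.prod_prod, measure_univ, mul_one] at e'
    exact e'.symm
  filter_upwards [measure_eq_zero_iff_ae_notMem.1 hBμ] with x hx
  exact pos_iff_ne_zero.2 hx

/-- A probability measure almost all of whose points are atoms has full mass on a countable set. -/
theorem exists_countable_measure_eq_one_of_ae_pos {α : Type*} [MeasurableSpace α]
    [MeasurableSingletonClass α] {μ : Measure α} [IsProbabilityMeasure μ]
    (h : ∀ᵐ x ∂μ, 0 < μ {x}) : ∃ D : Set α, D.Countable ∧ μ D = 1 := by
  refine ⟨{x | 0 < μ {x}}, ?_, ?_⟩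
  · exact Measure.countable_meas_pos_of_disjoint_iUnion (fun x => measurableSet_singleton x)
      fun x y hxy => Set.disjoint_singleton.2 hxy
  · rw [← measure_univ (μ := μ)]
    exact measure_eq_measure_of_null_sdiff (Set.subset_univ _) (by
      rw [← Set.compl_eq_univ_sdiff]; exact h)

/-- Theorem 2(c): if `q*` is the largest point of the support of `F` (the law of
`R_{1,2}`) and `F({q*}) > 0`, then for almost all `ω` the directing measure
`μ_ω` is discrete: `μ_ω`-almost every point is an atom, and `μ_ω` is the sum of
countably many point masses of total mass one. -/
theorem directing_measure_discrete
    {Ω₁ Ω : Type*} [MeasurableSpace Ω₁] [MeasurableSpace Ω]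
    (P : Measure Ω₁) [IsProbabilityMeasure P] (Pr : Measure Ω) [IsProbabilityMeasure Pr]
    (R : Ω₁ → Mat) (hGdF : IsGramDeFinetti P R) (hGGI : SatisfiesGGI P R)
    (η : Kernel Ω (H × ℝ)) [IsMarkovKernel η]
    (hpos : ∀ ω, η ω {p | p.2 < 0} = 0)
    (ν : Kernel Ω (ℕ → H × ℝ)) [IsMarkovKernel ν]
    (hiid : ∀ ω, IsIIDFrom (ν ω) (η ω))
    (hrep : ∀ A : Set Mat, MeasurableSet A →
      Measure.map R P A = ∫⁻ ω, Measure.map genMat (ν ω) A ∂Pr)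
    (μ : Ω → Measure H) (hμ : ∀ ω, μ ω = (η ω).map Prod.fst)
    (F : Measure ℝ) (hF : F = Measure.map (fun ω₁ => R ω₁ 0 1) P)
    (qs : ℝ) (hqs_top : F (Set.Ioi qs) = 0)
    (hqs_supp : ∀ ε : ℝ, 0 < ε → 0 < F (Set.Ioo (qs - ε) (qs + ε)))
    (hatom : 0 < F {qs}) :
    ∀ᵐ ω ∂Pr, (∀ᵐ x ∂(μ ω), 0 < μ ω {x}) ∧
      ∃ D : Set H, D.Countable ∧ μ ω D = 1 := by
  have hR : Measurable R := hGdF.1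
  have transfer : ∀ A : Set Mat, MeasurableSet A → P (R ⁻¹' A) = 0 →
      ∀ᵐ ω ∂Pr, ν ω (genMat ⁻¹' A) = 0 := by
    intro A hA h0
    have e := hrep A hA
    simp only [Measure.map_apply hR hA, Measure.map_apply measurable_genMat hA] at e
    rw [h0] at e
    exact (lintegral_eq_zero_iff (ν.measurable_coe (measurable_genMat hA))).1 e.symm
  have hm01 : Measurable fun ω₁ => R ω₁ 0 1 := by fun_prop
  have hentry : Measurable fun M : Mat => M 0 1 := by fun_prop
  rw [hF, Measure.map_apply hm01 measurableSet_Ioi] at hqs_top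
  rw [hF, Measure.map_apply hm01 (measurableSet_singleton qs)] at hatom
  have hN : MeasurableSet {M : Mat | ∀ l, 0 < l → M 0 l ≠ qs} := by
    have : {M : Mat | ∀ l, 0 < l → M 0 l ≠ qs} = ⋂ n, rowAvoids qs n := by
      ext M
      simp only [rowAvoids, Set.mem_iInter, Set.mem_ofPred_eq]
      exact ⟨fun h _ l hl _ => h l hl, fun h l hl => h (l + 1) l hl (by omega)⟩
    rw [this]
    exact MeasurableSet.iInter fun n => measurableSet_rowAvoids qs n
  filter_upwards [transfer _ hN (hGGI.measure_forall_ne_eq_zero hR hatom),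
    transfer _ (hentry measurableSet_Ioi) hqs_top] with ω hω hω'
  have : SecondCountableTopology H := UniformSpace.secondCountable_of_separable H
  have : IsProbabilityMeasure (μ ω) := by
    rw [hμ]; exact Measure.isProbabilityMeasure_map measurable_fst.aemeasurable
  have hoff : ∀ (x : ℕ → H × ℝ) (l : ℕ), 0 < l → genMat x 0 l = ⟪(x 0).1, (x l).1⟫ := by
    intro x l hl
    simp [genMat, hl.ne]
  have hinner : ∀ᵐ x ∂μ ω, 0 < μ ω {y | ⟪x, y⟫ = qs} := by
    rw [hμ]
    refine (hiid ω).ae_pos_measure_inner_eq (measure_mono_null (fun x hx => ?_) hω)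
    intro l hl
    rw [hoff x l hl]
    exact hx l hl
  have hnorm : ∀ᵐ x ∂μ ω, ⟪x, x⟫ ≤ qs := by
    refine ae_inner_self_le_of_prod ?_
    have hm : MeasurableSet {z : H × H | qs < ⟪z.1, z.2⟫} :=
      measurableSet_lt measurable_const (measurable_fst.inner measurable_snd)
    rw [hμ, Measure.map_prod_map _ _ measurable_fst measurable_fst,
      ← (hiid ω).map_pair zero_ne_one, Measure.map_map (by fun_prop) (by fun_prop),
      Measure.map_apply (by fun_prop) hm]
    refine measure_mono_null (fun x hx => ?_) hω'
    change qs < genMat x 0 1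
    rw [hoff x 1 one_pos]
    exact hx
  have hatoms : ∀ᵐ x ∂μ ω, 0 < μ ω {x} := by
    filter_upwards [hinner, hnorm] with x hx hxn
    refine hx.trans_le (measure_mono_ae ?_)
    filter_upwards [hnorm] with y hyn hy
    have hxy : ⟪x, y⟫ = qs := hy
    have hsq := real_inner_self_nonneg (x := x - y)
    have hexp : ⟪x - y, x - y⟫ = ⟪x, x⟫ - 2 * ⟪x, y⟫ + ⟪y, y⟫ := by
      rw [inner_sub_left, inner_sub_right, inner_sub_right, real_inner_comm x y]
      ring
    have h0 : ⟪x - y, x - y⟫ = 0 := by linarith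
    exact (sub_eq_zero.1 (inner_self_eq_zero.1 h0)).symm
  exact ⟨hatoms, exists_countable_measure_eq_one_of_ae_pos hatoms⟩

end
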